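/- Correctness of the greedy augmentation for length-2 lists: if in each iteration one duplicates a minimum-cost item that is odd with respect to a maximum matching of the current graph H'_i of f- and s-edges, then the size of the maximum matching of H' increases by exactly one per iteration, the f- and s-items of every person remain unchanged throughout, and after |A| − |M_0| iterations the resulting graph admits a popular matching; moreover the total cost of duplicated items is minimum among all augmentations yielding a graph with a popular matching. -/

import Mathlib

universe u v

/-- Number of people matched to item `b`. -/
noncomputable def usage {α β : Type*} [Fintype α] (M : α → Option β) (b : β) : ℕ :=
  Nat.card {a // M a = some b}

/-- A matching of the bipartite graph `E` in which each item `b` may be matched to up to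
`copies b` people. -/
def IsCapMatchingOn {α β : Type*} [Fintype α] (E : α → β → Prop) (copies : β → ℕ)
    (M : α → Option β) : Prop :=
  (∀ a b, M a = some b → E a b) ∧ ∀ b, usage M b ≤ copies b

/-- Number of matched people. -/
noncomputable def msize {α β : Type*} [Fintype α] (M : α → Option β) : ℕ :=
  Nat.card {a // (M a).isSome}

/-- A maximum cardinality capacitated matching of `E`. -/
def IsMaxCapMatchingOn {α β : Type*} [Fintype α] (E : α → β → Prop) (copies : β → ℕ)
    (M : α → Option β) : Prop :=
  IsCapMatchingOn E copies M ∧ ∀ M', IsCapMatchingOn E copies M' → msize M' ≤ msize M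

mutual
  /-- A person reachable by an even-length alternating path from an unmatched vertex
  (capacitated graph). -/
  inductive CEvenA {α : Type u} {β : Type v} [Fintype α] (E : α → β → Prop)
      (copies : β → ℕ) (M : α → Option β) : α → Prop
    | base (a : α) : M a = none → CEvenA E copies M a
    | step (a : α) (b : β) : COddB E copies M b → M a = some b → CEvenA E copies M a
  /-- An item reachable by an odd-length alternating path from an unmatched vertex
  (capacitated graph). -/
  inductive COddB {α : Type u} {β : Type v} [Fintype α] (E : α → β → Prop)
      (copies : β → ℕ) (M : α → Option β) : β → Prop
    | step (a : α) (b : β) : CEvenA E copies M a → E a b → M a ≠ some b →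
        COddB E copies M b
end

mutual
  /-- An item reachable by an even-length alternating path from an unmatched vertex:
  either it is not fully matched, or reached through a matching edge from an odd person. -/
  inductive CEvenB {α : Type u} {β : Type v} [Fintype α] (E : α → β → Prop)
      (copies : β → ℕ) (M : α → Option β) : β → Prop
    | base (b : β) : usage M b < copies b → CEvenB E copies M b
    | step (a : α) (b : β) : COddA E copies M a → M a = some b → CEvenB E copies M b
  /-- A person reachable by an odd-length alternating path from an unmatched vertex. -/
  inductive COddA {α : Type u} {β : Type v} [Fintype α] (E : α → β → Prop)
      (copies : β → ℕ) (M : α → Option β) : α → Prop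
    | step (a : α) (b : β) : CEvenB E copies M b → E a b → M a ≠ some b →
        COddA E copies M a
end

attribute [local instance] Classical.propDecidable

/-- Person `a` prefers matching `M` to `M'`. -/
def Prefers {α β : Type*} (rank : α → β → ℕ∞) (M M' : α → Option β) (a : α) : Prop :=
  (∃ b, M a = some b ∧ M' a = none) ∨
  (∃ b b', M a = some b ∧ M' a = some b' ∧ rank a b < rank a b')

/-- `M'` is more popular than `M`. -/
def MorePopular {α β : Type*} [Fintype α] (rank : α → β → ℕ∞) (M' M : α → Option β) : Prop :=
  Nat.card {a // Prefers rank M M' a} < Nat.card {a // Prefers rank M' M a}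

/-- `(a,b)` is an edge of the instance. -/
def Edge {α β : Type*} (rank : α → β → ℕ∞) (a : α) (b : β) : Prop := rank a b ≠ ⊤

/-- A popular matching of the capacitated instance. -/
def PopularCap {α β : Type*} [Fintype α] (rank : α → β → ℕ∞) (copies : β → ℕ)
    (M : α → Option β) : Prop :=
  (IsCapMatchingOn (Edge rank) copies M) ∧
  ∀ M', IsCapMatchingOn (Edge rank) copies M' → ¬ MorePopular rank M' M

/-- The rank-1 subgraph `G1` of an instance with strict lists of length at most 2. -/
def E1f {α β : Type*} (f : α → β) (a : α) (b : β) : Prop := b = f a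

/-- The `s`-item of a person computed in the capacitated rank-1 graph with `copies`
copies of each item, relative to a maximum matching `M1` of that graph. -/
noncomputable def sItemC {α β : Type*} [Fintype α] (f : α → β) (z : α → Option β)
    (last : α → β) (copies : β → ℕ) (M1 : α → Option β) (a : α) : β :=
  match z a with
  | some c => if CEvenB (E1f f) copies M1 c then c else last a
  | none => last a

/-- The edges of `G'`: each person to her top item, and each person even in `G1` to her
`s`-item (all computed in the original graph, one copy of each item). -/
def Ered {α β : Type*} [Fintype α] (f : α → β) (z : α → Option β) (last : α → β)
    (M1 : α → Option β) (a : α) (b : β) : Prop :=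
  b = f a ∨ (CEvenA (E1f f) (fun _ => 1) M1 a ∧ b = sItemC f z last (fun _ => 1) M1 a)

/-- The preference lists as a rank function: `f a` first, `z a` second, `last a` last. -/
noncomputable def rankOf {α β : Type*} (f : α → β) (z : α → Option β) (last : α → β) :
    α → β → ℕ∞ := fun a b =>
  if b = f a then 1 else if z a = some b then 2 else if b = last a then 3 else ⊤

section Helpers

/-- Number of people assigned to `o`. -/
noncomputable def cnt {α β : Type*} [Fintype α] (M : α → Option β) (o : Option β) : ℕ :=
  (Finset.univ.filter (fun a => M a = o)).card

variable {α : Type u} {β : Type v} [Fintype α]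

lemma usage_eq_cnt (M : α → Option β) (b : β) : usage M b = cnt M (some b) := by
  unfold usage cnt
  rw [Nat.card_eq_fintype_card, Fintype.card_subtype]

lemma msize_add_cnt (M : α → Option β) : msize M + cnt M none = Fintype.card α := by
  unfold msize cnt
  rw [Nat.card_eq_fintype_card, Fintype.card_subtype, ← Finset.card_univ,
    ← Finset.card_filter_add_card_filter_not (s := Finset.univ) (fun a => (M a).isSome)]
  simp

lemma cnt_update (M : α → Option β) (a : α) (o o' : Option β) :
    cnt (Function.update M a o) o' + (if M a = o' then 1 else 0)
      = cnt M o' + (if o = o' then 1 else 0) := by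
  unfold cnt
  have h : ∀ N : α → Option β, (Finset.univ.filter (fun x => N x = o')).card
      = ((Finset.univ.erase a).filter (fun x => N x = o')).card
        + (if N a = o' then 1 else 0) := by
    intro N
    rw [← Finset.insert_erase (Finset.mem_univ a), Finset.filter_insert]
    split_ifs with h
    · rw [Finset.card_insert_of_notMem (by simp)]; simp
    · simp
  rw [h M, h (Function.update M a o)]
  have : (Finset.univ.erase a).filter (fun x => Function.update M a o x = o')
      = (Finset.univ.erase a).filter (fun x => M x = o') := by
    apply Finset.filter_congr
    intro x hx
    rw [Function.update_of_ne (Finset.ne_of_mem_erase hx)]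
  rw [this, Function.update_self]
  omega

/-- one exchange step -/
def XStep (E : α → β → Prop) (M : α → Option β) (x : Option β) (o : Option β) : Prop :=
  ∃ a b, x = some b ∧ E a b ∧ M a = o

/-- exchange paths of given length -/
def Pth (E : α → β → Prop) (M : α → Option β) (b : β) : ℕ → Option β → Prop
  | 0, o => o = some b
  | n + 1, o => ∃ y, Pth E M b n y ∧ XStep E M y o

lemma Pth_update (E : α → β → Prop) (M : α → Option β) (b : β) (a : α) (w : Option β)
    (m : ℕ) : ∀ y, (∀ m' ≤ m, ¬ Pth E M b m' (M a)) → Pth E M b m y →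
      Pth E (Function.update M a w) b m y := by
  induction m with
  | zero => intro y _ h; exact h
  | succ m ih =>
    intro y hn h
    have hy := h
    obtain ⟨y', h1, a', b', rfl, h2, h3⟩ := h
    refine ⟨some b', ih _ (fun m' hm => hn m' (by omega)) h1, a', b', rfl, h2, ?_⟩
    rw [Function.update_of_ne, h3]
    rintro rfl
    rw [← h3] at hy
    exact hn (m + 1) le_rfl hy

lemma shift (E : α → β → Prop) (b : β) (n : ℕ) : ∀ (M : α → Option β) (o : Option β),
    Pth E M b n o → ∃ M' : α → Option β,
      (∀ a x, M' a = some x → M a = some x ∨ E a x) ∧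
      (∀ a, M' a = none → M a = none) ∧
      ∀ o', cnt M' o' + (if o = o' then 1 else 0) = cnt M o' + (if some b = o' then 1 else 0) := by
  induction n using Nat.strong_induction_on with
  | _ n ih =>
    intro M o h
    by_cases hs : ∃ m < n, Pth E M b m o
    · obtain ⟨m, hm, h'⟩ := hs
      exact ih m hm M o h'
    push Not at hs
    cases n with
    | zero =>
      change o = some b at h
      subst h
      exact ⟨M, fun a x h => Or.inl h, fun a h => h, fun o' => rfl⟩
    | succ n =>
      obtain ⟨y, h1, a, b', rfl, h2, h3⟩ := h
      have hp : Pth E (Function.update M a (some b')) b n (some b') := by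
        apply Pth_update _ _ _ _ _ _ _ _ h1
        intro m' hm'
        rw [h3]
        exact hs m' (by omega)
      obtain ⟨M', hE, hN, hc⟩ := ih n (by omega) _ _ hp
      refine ⟨M', ?_, ?_, ?_⟩
      · intro a' x hx
        rcases hE a' x hx with h | h
        · by_cases haa : a' = a
          · subst haa
            rw [Function.update_self] at h
            cases h
            exact Or.inr h2
          · rw [Function.update_of_ne haa] at h
            exact Or.inl h
        · exact Or.inr h
      · intro a' hx
        have h := hN a' hx
        by_cases haa : a' = a
        · subst haa
          rw [Function.update_self] at h
          cases h
        · rwa [Function.update_of_ne haa] at h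
      · intro o'
        have e1 := hc o'
        have e2 := cnt_update M a (some b') o'
        rw [h3] at e2
        omega

lemma Pth_of_rtg (E : α → β → Prop) (M : α → Option β) (b : β) (o : Option β)
    (h : Relation.ReflTransGen (XStep E M) (some b) o) : ∃ n, Pth E M b n o := by
  induction h with
  | refl => exact ⟨0, rfl⟩
  | tail _ h2 ih =>
    obtain ⟨n, hn⟩ := ih
    exact ⟨n + 1, _, hn, h2⟩

lemma rtg_of_odd (E : α → β → Prop) (c : β → ℕ) (M : α → Option β) (b : β)
    (h : COddB E c M b) : Relation.ReflTransGen (XStep E M) (some b) none := by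
  refine COddB.rec (E := E) (copies := c) (M := M)
    (motive_1 := fun a _ => Relation.ReflTransGen (XStep E M) (M a) none)
    (motive_2 := fun b _ => Relation.ReflTransGen (XStep E M) (some b) none) ?_ ?_ ?_ h
  · intro a ha
    rw [ha]
  · intro a b _ hab ih
    rw [hab]; exact ih
  · intro a b _ hE _ ih
    exact Relation.ReflTransGen.head ⟨a, b, rfl, hE, rfl⟩ ih

lemma even_nbr (E : α → β → Prop) (c : β → ℕ) (M : α → Option β) (a : α) (b : β)
    (ha : CEvenA E c M a) (hE : E a b) : COddB E c M b := by
  by_cases h : M a = some b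
  · cases ha with
    | base _ h0 => rw [h] at h0; cases h0
    | step _ b' hb' h0 => rw [h] at h0; cases h0; exact hb'
  · exact COddB.step a b ha hE h

/-- augmentation -/
lemma augment (E : α → β → Prop) (c : β → ℕ) (M : α → Option β) (b : β)
    (hM : IsCapMatchingOn E c M) (h : COddB E c M b) :
    ∃ M' : α → Option β, (∀ a x, M' a = some x → E a x) ∧ msize M' = msize M + 1 ∧
      ∀ x, usage M' x = usage M x + (if b = x then 1 else 0) := by
  obtain ⟨n, hn⟩ := Pth_of_rtg _ _ _ _ (rtg_of_odd E c M b h)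
  obtain ⟨M', h1, _, h2⟩ := shift E b n M none hn
  refine ⟨M', fun a x hx => (h1 a x hx).elim (hM.1 a x) id, ?_, ?_⟩
  · have e1 := h2 none
    have e2 := msize_add_cnt M
    have e3 := msize_add_cnt M'
    simp at e1
    omega
  · intro x
    have e1 := h2 (some x)
    rw [usage_eq_cnt, usage_eq_cnt]
    simpa using e1

lemma odd_saturated (E : α → β → Prop) (c : β → ℕ) (M : α → Option β) (b : β)
    (hM : IsMaxCapMatchingOn E c M) (h : COddB E c M b) : usage M b = c b := by
  by_contra hne
  obtain ⟨M', h1, h2, h3⟩ := augment E c M b hM.1 h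
  have := hM.2 M' ⟨h1, fun x => by
    have e := h3 x
    have e2 := hM.1.2 x
    split_ifs at e with hx
    · subst hx; omega
    · omega⟩
  omega

lemma exists_max (E : α → β → Prop) [Fintype β] (c : β → ℕ) :
    ∃ M, IsMaxCapMatchingOn E c M := by
  obtain ⟨M, hM, hmax⟩ := Set.exists_max_image {M | IsCapMatchingOn E c M} msize
    (Set.toFinite _) ⟨fun _ => none, fun a b h => by simp at h, fun b => by simp [usage]⟩
  exact ⟨M, hM, fun M' h => hmax M' h⟩

lemma max_step (E : α → β → Prop) (c : β → ℕ) (M : α → Option β) (b : β)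
    (hM : IsMaxCapMatchingOn E c M) (h : COddB E c M b) (M' : α → Option β)
    (hM' : IsMaxCapMatchingOn E (Function.update c b (c b + 1)) M') :
    msize M' = msize M + 1 := by
  apply le_antisymm
  · by_cases hu : usage M' b ≤ c b
    · have := hM.2 M' ⟨hM'.1.1, fun x => by
        have := hM'.1.2 x
        by_cases hx : x = b
        · subst hx; exact hu
        · rwa [Function.update_of_ne hx] at this⟩
      omega
    · have : ∃ a, M' a = some b := by
        by_contra hne
        push Not at hne
        apply hu
        rw [usage_eq_cnt, cnt, Finset.filter_false_of_mem (by simpa using hne)]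
        simp
      obtain ⟨a, ha⟩ := this
      have hc := cnt_update M' a none
      have := hM.2 (Function.update M' a none) ⟨fun a' x hx => by
          by_cases haa : a' = a
          · subst haa; simp at hx
          · rw [Function.update_of_ne haa] at hx; exact hM'.1.1 _ _ hx,
        fun x => by
          have e := hM'.1.2 x
          have e1 := hc (some x)
          rw [usage_eq_cnt] at *
          rw [ha] at e1
          by_cases hx : x = b
          · subst hx; simp at e1 e; omega
          · rw [Function.update_of_ne hx] at e
            simp at e1; omega⟩
      have e1 := hc none
      have e2 := msize_add_cnt M'
      have e3 := msize_add_cnt (Function.update M' a none)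
      simp [ha] at e1
      omega
  · obtain ⟨N, h1, h2, h3⟩ := augment E c M b hM.1 h
    rw [← h2]
    apply hM'.2
    refine ⟨h1, fun x => ?_⟩
    have e := h3 x
    have e2 := hM.1.2 x
    by_cases hx : x = b
    · subst hx; simp at e ⊢; omega
    · rw [Function.update_of_ne hx, e, if_neg (Ne.symm hx)]; omega

/-- exchange -/
lemma exchange (E : α → β → Prop) (c d : β → ℕ) (M N : α → Option β) (b : β)
    (hM : IsMaxCapMatchingOn E c M) (h : COddB E c M b) (hN : IsCapMatchingOn E d N)
    (hNp : ∀ a, N a ≠ none) (hcd : ∀ x, c x ≤ d x) :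
    ∃ b' N', COddB E c M b' ∧ c b' < d b' ∧ (∀ a, N' a ≠ none) ∧ (∀ a x, N' a = some x → E a x)
      ∧ ∀ x, usage N' x + (if b' = x then 1 else 0) = usage N x + (if b = x then 1 else 0) := by
  set E' : α → β → Prop := fun a x => E a x ∧ CEvenA E c M a with hE'
  by_cases hg : ∃ y, COddB E c M y ∧ c y < d y ∧
      Relation.ReflTransGen (XStep E' N) (some b) (some y)
  · obtain ⟨y, h1, h2, h3⟩ := hg
    obtain ⟨n, hn⟩ := Pth_of_rtg _ _ _ _ h3
    obtain ⟨N', g1, g2, g3⟩ := shift E' b n N _ hn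
    refine ⟨y, N', h1, h2, fun a ha => hNp a (g2 a ha),
      fun a x hx => (g1 a x hx).elim (hN.1 a x) (fun h => h.1), fun x => ?_⟩
    rw [usage_eq_cnt, usage_eq_cnt]
    simpa using g3 (some x)
  exfalso
  push Not at hg
  have hodd : ∀ o, Relation.ReflTransGen (XStep E' N) (some b) o →
      ∃ y, o = some y ∧ COddB E c M y := by
    intro o ho
    induction ho with
    | refl => exact ⟨b, rfl, h⟩
    | tail _ h2 _ =>
      obtain ⟨a, x, _, ha, hNa⟩ := h2
      cases hy : N a with
      | none => exact absurd hy (hNp a)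
      | some y => exact ⟨y, by rw [← hNa, hy], even_nbr E c M a y ha.2 (hN.1 a y hy)⟩
  set R : Set β := {y | Relation.ReflTransGen (XStep E' N) (some b) (some y)} with hR
  have hRodd : ∀ y ∈ R, COddB E c M y := by
    intro y hy
    obtain ⟨y', h1, h2⟩ := hodd _ hy
    cases h1; exact h2
  have hRd : ∀ y ∈ R, d y = c y := fun y hy =>
    le_antisymm (by
      by_contra hlt
      exact hg y (hRodd y hy) (by omega) hy) (hcd y)
  set P : Finset α := Finset.univ.filter (fun a => ∃ x ∈ R, E' a x) with hP
  set Q : Finset α := Finset.univ.filter (fun a => ∃ x ∈ R, M a = some x) with hQ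
  set T : Finset α := Finset.univ.filter (fun a => ∃ x ∈ R, N a = some x) with hT
  have hQP : Q ⊆ P := by
    intro a ha
    simp only [hQ, hP, Finset.mem_filter, Finset.mem_univ, true_and] at ha ⊢
    obtain ⟨x, hx, hax⟩ := ha
    exact ⟨x, hx, hM.1.1 a x hax, CEvenA.step a x (hRodd x hx) hax⟩
  have hPT : P ⊆ T := by
    intro a ha
    simp only [hT, hP, Finset.mem_filter, Finset.mem_univ, true_and] at ha ⊢
    obtain ⟨x, hx, hax⟩ := ha
    have hst : Relation.ReflTransGen (XStep E' N) (some b) (N a) :=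
      Relation.ReflTransGen.tail hx ⟨a, x, rfl, hax, rfl⟩
    obtain ⟨y, h1, h2⟩ := hodd _ hst
    rw [h1] at hst
    exact ⟨y, hst, h1⟩
  have hTQ : T.card ≤ Q.card := by
    set I : Finset β := T.biUnion (fun a => (N a).toFinset) with hI
    have hIR : ∀ y ∈ I, y ∈ R := by
      intro y hy
      simp only [hI, hT, Finset.mem_biUnion, Finset.mem_filter, Finset.mem_univ, true_and,
        Option.mem_toFinset, Option.mem_def] at hy
      obtain ⟨a, ⟨x, hx, hax⟩, hay⟩ := hy
      rw [hax] at hay; cases hay; exact hx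
    have hT1 : T ⊆ I.biUnion (fun y => Finset.univ.filter (fun a => N a = some y)) := by
      intro a ha
      have ha' := ha
      simp only [hT, Finset.mem_filter, Finset.mem_univ, true_and] at ha
      obtain ⟨x, hx, hax⟩ := ha
      simp only [Finset.mem_biUnion, Finset.mem_filter, Finset.mem_univ, true_and]
      refine ⟨x, ?_, hax⟩
      simp only [hI, Finset.mem_biUnion, Option.mem_toFinset, Option.mem_def]
      exact ⟨a, ha', hax⟩
    have hQ1 : I.biUnion (fun y => Finset.univ.filter (fun a => M a = some y)) ⊆ Q := by
      intro a ha
      simp only [Finset.mem_biUnion, Finset.mem_filter, Finset.mem_univ, true_and] at ha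
      obtain ⟨y, hy, hay⟩ := ha
      simp only [hQ, Finset.mem_filter, Finset.mem_univ, true_and]
      exact ⟨y, hIR y hy, hay⟩
    calc T.card ≤ _ := Finset.card_le_card hT1
      _ ≤ ∑ y ∈ I, (Finset.univ.filter (fun a => N a = some y)).card := Finset.card_biUnion_le
      _ ≤ ∑ y ∈ I, (Finset.univ.filter (fun a => M a = some y)).card := by
          apply Finset.sum_le_sum
          intro y hy
          have e1 := hN.2 y
          have e2 := odd_saturated E c M y hM (hRodd y (hIR y hy))
          have e3 := hRd y (hIR y hy)
          rw [usage_eq_cnt, cnt] at e1 e2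
          omega
      _ = _ := by
          rw [Finset.card_biUnion]
          intro x _ y _ hxy
          rw [Function.onFun, Finset.disjoint_left]
          intro a ha hb
          simp only [Finset.mem_filter, Finset.mem_univ, true_and] at ha hb
          rw [ha] at hb
          cases hb
          exact hxy rfl
      _ ≤ Q.card := Finset.card_le_card hQ1
  have hPQ : Q = P := Finset.eq_of_subset_of_card_le hQP
    ((Finset.card_le_card hPT).trans hTQ)
  have key : ∀ a x, E' a x → x ∈ R → ∃ y ∈ R, M a = some y := by
    intro a x h1 h2
    have : a ∈ Q := by
      rw [hPQ]
      simp only [hP, Finset.mem_filter, Finset.mem_univ, true_and]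
      exact ⟨x, h2, h1⟩
    simpa [hQ] using this
  have fin : b ∈ R → False := by
    refine COddB.rec (E := E) (copies := c) (M := M)
      (motive_1 := fun a _ => ∀ y ∈ R, M a = some y → False)
      (motive_2 := fun b _ => b ∈ R → False) ?_ ?_ ?_ h
    · intro a ha y _ h2
      rw [ha] at h2; cases h2
    · intro a x _ hax ih y hy h2
      rw [hax] at h2; cases h2; exact ih hy
    · intro a x hev hE _ ih hx
      obtain ⟨y, hy, hay⟩ := key a x ⟨hE, hev⟩ hx
      exact ih y hy hay
  exact fin Relation.ReflTransGen.refl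

end Helpers

section Helpers2

variable {α : Type u} {β : Type v} [Fintype α]

lemma greedy_opt [Fintype β] (E : α → β → Prop) (cost : β → ℝ) (k : ℕ) (seq : ℕ → β → ℕ)
    (hstep : ∀ i < k, ∃ b Mi, IsMaxCapMatchingOn E (seq i) Mi ∧ COddB E (seq i) Mi b ∧
      (∀ b', COddB E (seq i) Mi b' → cost b ≤ cost b') ∧
      seq (i + 1) = Function.update (seq i) b (seq i b + 1))
    (c' : β → ℕ) (N : α → Option β) (hN : IsCapMatchingOn E c' N) (hNp : ∀ a, N a ≠ none)
    (h0 : ∀ x, seq 0 x ≤ c' x) (i : ℕ) (hi : i ≤ k) :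
    ∃ d N, (∀ x, seq i x ≤ d x) ∧ IsCapMatchingOn E d N ∧ (∀ a, N a ≠ none) ∧
      ∑ b : β, (d b : ℝ) * cost b ≤ ∑ b : β, (c' b : ℝ) * cost b := by
  induction i with
  | zero => exact ⟨c', N, h0, hN, hNp, le_rfl⟩
  | succ i ih =>
    obtain ⟨d, N, hd, hN, hNp, hc⟩ := ih (by omega)
    obtain ⟨b, Mi, hMi, hodd, hmin, hs⟩ := hstep i (by omega)
    obtain ⟨b', N', h1, h2, h3, h4, h5⟩ := exchange E (seq i) d Mi N b hMi hodd hN hNp hd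
    have hsub : ∀ x, (if b' = x then 1 else 0) ≤ d x := by
      intro x
      split_ifs with h
      · subst h; omega
      · omega
    refine ⟨fun x => d x - (if b' = x then 1 else 0) + (if b = x then 1 else 0), N', ?_,
      ⟨h4, ?_⟩, h3, ?_⟩
    · intro x
      rw [hs]
      have := hd x
      by_cases hx : x = b
      · subst hx
        by_cases hy : b' = x
        · subst hy; simp; omega
        · simp [hy]; omega
      · rw [Function.update_of_ne hx]
        by_cases hy : b' = x
        · subst hy; simp; omega
        · simp [hy]; omega
    · intro x
      have := h5 x
      have := hN.2 x
      have := hsub x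
      dsimp only
      omega
    · refine le_trans ?_ hc
      have : ∀ x, ((d x - (if b' = x then 1 else 0) + (if b = x then 1 else 0) : ℕ) : ℝ) * cost x
          = (d x : ℝ) * cost x - (if b' = x then cost x else 0) + (if b = x then cost x else 0) := by
        intro x
        rw [Nat.cast_add, Nat.cast_sub (hsub x)]
        split_ifs <;> simp <;> ring
      rw [Finset.sum_congr rfl (fun x _ => this x), Finset.sum_add_distrib, Finset.sum_sub_distrib]
      simp
      linarith [hmin b' h1]

lemma size_seq [Fintype β] (E : α → β → Prop) (cost : β → ℝ) (k : ℕ) (seq : ℕ → β → ℕ)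
    (hstep : ∀ i < k, ∃ b Mi, IsMaxCapMatchingOn E (seq i) Mi ∧ COddB E (seq i) Mi b ∧
      (∀ b', COddB E (seq i) Mi b' → cost b ≤ cost b') ∧
      seq (i + 1) = Function.update (seq i) b (seq i b + 1)) (i : ℕ) (hi : i < k)
    (Mi Mj : α → Option β) (hMi : IsMaxCapMatchingOn E (seq i) Mi)
    (hMj : IsMaxCapMatchingOn E (seq (i + 1)) Mj) : msize Mj = msize Mi + 1 := by
  obtain ⟨b, M, hM, hodd, _, hs⟩ := hstep i hi
  rw [hs] at hMj
  have := max_step E (seq i) M b hM hodd Mj hMj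
  have := hM.2 Mi hMi.1
  have := hMi.2 M hM.1
  omega

lemma isSome_of_msize (M : α → Option β) (h : Fintype.card α ≤ msize M) (a : α) :
    (M a).isSome := by
  have := msize_add_cnt M
  have h0 : cnt M none = 0 := by omega
  rw [cnt, Finset.card_eq_zero, Finset.filter_eq_empty_iff] at h0
  exact Option.isSome_iff_ne_none.mpr (h0 (Finset.mem_univ a))

lemma evenB_iff (f : α → β) (c : β → ℕ) (M : α → Option β)
    (hM : IsCapMatchingOn (E1f f) c M) (b : β) :
    CEvenB (E1f f) c M b ↔ usage M b < c b := by
  constructor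
  · intro h
    cases h with
    | base _ h => exact h
    | step a _ ha hab =>
      cases ha with
      | step _ b' hb' hE hne =>
        have h1 := hM.1 a b hab
        unfold E1f at h1 hE
        subst h1; subst hE
        exact absurd hab hne
  · exact CEvenB.base b

lemma cnt_le_of_imp (M : α → Option β) (b : β) (p : α → Prop) (h : ∀ a, M a = some b → p a) :
    usage M b ≤ (Finset.univ.filter p).card := by
  rw [usage_eq_cnt]
  apply Finset.card_le_card
  intro a
  simpa using h a

/-- number of people whose top item is `b` -/
noncomputable def fdeg (f : α → β) (b : β) : ℕ := (Finset.univ.filter (fun a => f a = b)).card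

lemma evenB_iff' (f : α → β) (c : β → ℕ) (M : α → Option β)
    (hM : IsMaxCapMatchingOn (E1f f) c M) (b : β) (h1 : 1 ≤ c b)
    (h2 : ∀ a, f a = b → c b ≤ fdeg f b) :
    CEvenB (E1f f) c M b ↔ ∀ a, f a ≠ b := by
  rw [evenB_iff f c M hM.1]
  constructor
  · intro h a ha
    have hc := h2 a ha
    have : ∃ a', f a' = b ∧ M a' ≠ some b := by
      by_contra hne
      push Not at hne
      have : fdeg f b ≤ usage M b := by
        rw [usage_eq_cnt]
        apply Finset.card_le_card
        intro a
        simpa using hne a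
      omega
    obtain ⟨a', h3, h4⟩ := this
    have hnone : M a' = none := by
      cases hx : M a' with
      | none => rfl
      | some x =>
        have := hM.1.1 a' x hx
        unfold E1f at this
        rw [this, h3] at hx
        exact absurd hx h4
    have hcu := cnt_update M a' (some b)
    have := hM.2 (Function.update M a' (some b)) ⟨fun a'' x hx => by
        by_cases haa : a'' = a'
        · subst haa; rw [Function.update_self] at hx; cases hx; exact h3.symm
        · rw [Function.update_of_ne haa] at hx; exact hM.1.1 _ _ hx,
      fun x => by
        have e := hM.1.2 x
        have e1 := hcu (some x)
        rw [usage_eq_cnt] at *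
        rw [hnone] at e1
        by_cases hx : b = x
        · subst hx; simp at e1; omega
        · simp [hx] at e1; omega⟩
    have e1 := hcu none
    have e2 := msize_add_cnt M
    have e3 := msize_add_cnt (Function.update M a' (some b))
    simp [hnone] at e1
    omega
  · intro h
    have : usage M b = 0 := by
      rw [usage_eq_cnt, cnt, Finset.card_eq_zero, Finset.filter_eq_empty_iff]
      intro a _ ha
      exact h a (hM.1.1 a b ha).symm
    omega

/-- explicit s-item -/
noncomputable def sx (f : α → β) (z : α → Option β) (last : α → β) (a : α) : β :=
  match z a with
  | some c => if ∀ a', f a' ≠ c then c else last a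
  | none => last a

lemma sItemC_eq (f : α → β) (z : α → Option β) (last : α → β) (c : β → ℕ) (M : α → Option β)
    (hM : IsMaxCapMatchingOn (E1f f) c M) (h1 : ∀ b, 1 ≤ c b)
    (h2 : ∀ a, c (f a) ≤ fdeg f (f a)) (a : α) :
    sItemC f z last c M a = sx f z last a := by
  unfold sItemC sx
  cases z a with
  | none => rfl
  | some x =>
    simp only [evenB_iff' f c M hM x (h1 x) (fun a ha => by subst ha; exact h2 a)]

lemma fdeg_pos (f : α → β) (a : α) : 1 ≤ fdeg f (f a) :=
  Finset.card_pos.mpr ⟨a, by simp⟩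

lemma sx_ne_f (f : α → β) (z : α → Option β) (last : α → β)
    (hpriv : ∀ a a', f a' ≠ last a ∧ z a' ≠ some (last a)) (a a' : α) :
    sx f z last a ≠ f a' := by
  unfold sx
  cases z a with
  | none => exact (hpriv a a').1.symm
  | some x =>
    dsimp only
    split_ifs with h
    · exact (h a').symm
    · exact (hpriv a a').1.symm

lemma sx_cases (f : α → β) (z : α → Option β) (last : α → β) (a : α) :
    (z a = some (sx f z last a) ∧ ∀ a', f a' ≠ sx f z last a) ∨
    (sx f z last a = last a ∧ ∀ x, z a = some x → ∃ a', f a' = x) := by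
  unfold sx
  cases z a with
  | none => right; simp
  | some x =>
    dsimp only
    split_ifs with h
    · left; exact ⟨rfl, h⟩
    · right; push Not at h; refine ⟨rfl, ?_⟩; rintro y ⟨⟩; exact h

lemma evenA_of (f : α → β) (M : α → Option β) (hM : IsMaxCapMatchingOn (E1f f) (fun _ => 1) M)
    (a a' : α) (hne : a' ≠ a) (hf : f a' = f a) : CEvenA (E1f f) (fun _ => 1) M a := by
  have hc : ∀ x y, M x = some y → y = f x := hM.1.1
  cases h : M a with
  | none => exact CEvenA.base a h
  | some y =>
    have := hc a y h
    subst this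
    have h' : M a' = none := by
      cases h2 : M a' with
      | none => rfl
      | some y =>
        have := hc a' y h2
        rw [this, hf] at h2
        have hu := hM.1.2 (f a)
        rw [usage_eq_cnt, cnt, Finset.card_le_one] at hu
        exact absurd (hu a' (by simpa using h2) a (by simpa using h)) hne
    exact CEvenA.step a (f a) (COddB.step a' (f a) (CEvenA.base a' h') hf.symm (by simp [h'])) h

/-- capacity invariant along the run -/
lemma seq_inv (f : α → β) (E : α → β → Prop)
    (hEf : ∀ a a', E a (f a') → f a = f a') (cost : β → ℝ) (k : ℕ) (seq : ℕ → β → ℕ)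
    (hseq0 : seq 0 = fun _ => 1)
    (hstep : ∀ i < k, ∃ b Mi, IsMaxCapMatchingOn E (seq i) Mi ∧ COddB E (seq i) Mi b ∧
      (∀ b', COddB E (seq i) Mi b' → cost b ≤ cost b') ∧
      seq (i + 1) = Function.update (seq i) b (seq i b + 1)) (i : ℕ) (hi : i ≤ k) :
    (∀ b, 1 ≤ seq i b) ∧ ∀ a, seq i (f a) ≤ fdeg f (f a) := by
  induction i with
  | zero => simp [hseq0, fdeg_pos]
  | succ i ih =>
    obtain ⟨h1, h2⟩ := ih (by omega)
    obtain ⟨b, M, hM, hodd, _, hs⟩ := hstep i (by omega)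
    rw [hs]
    refine ⟨fun x => ?_, fun a => ?_⟩
    · by_cases hx : x = b
      · subst hx; simp
      · rw [Function.update_of_ne hx]; exact h1 x
    · by_cases hx : f a = b
      · subst hx
        rw [Function.update_self]
        have hsat := odd_saturated E _ M _ hM hodd
        cases hodd with
        | step a' _ hev hE hne =>
          have hfa := hEf _ _ hE
          rw [← hsat, usage_eq_cnt, cnt, fdeg, Nat.succ_le_iff]
          apply Finset.card_lt_card
          rw [Finset.ssubset_iff_of_subset]
          · exact ⟨a', by simpa using hfa, by simpa using hne⟩
          · intro x hx
            simp only [Finset.mem_filter, Finset.mem_univ, true_and] at hx ⊢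
            exact hEf _ _ (hM.1.1 x _ hx)
      · rw [Function.update_of_ne hx]; exact h2 a

/-- promote people to top items until these are full -/
lemma exists_full [Fintype β] (f : α → β) (E : α → β → Prop) (hE1 : ∀ a, E a (f a))
    (c : β → ℕ)
    (hc : ∀ a, c (f a) ≤ fdeg f (f a)) (M : α → Option β) (hM : IsCapMatchingOn E c M)
    (hMp : ∀ a, M a ≠ none) :
    ∃ M, IsCapMatchingOn E c M ∧ (∀ a, M a ≠ none) ∧ ∀ a, usage M (f a) = c (f a) := by
  obtain ⟨N, ⟨hN, hNp⟩, hmax⟩ := Set.exists_max_image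
    {M | IsCapMatchingOn E c M ∧ ∀ a, M a ≠ none}
    (fun M => (Finset.univ.filter (fun a => M a = some (f a))).card)
    (Set.toFinite _) ⟨M, hM, hMp⟩
  refine ⟨N, hN, hNp, fun a => ?_⟩
  by_contra hne
  have hlt := lt_of_le_of_ne (hN.2 (f a)) hne
  have : ∃ a', f a' = f a ∧ N a' ≠ some (f a) := by
    by_contra hne
    push Not at hne
    have : fdeg f (f a) ≤ usage N (f a) := by
      rw [usage_eq_cnt]
      apply Finset.card_le_card
      intro a'
      simpa using hne a'
    have := hc a
    omega
  obtain ⟨a', h1, h2⟩ := this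
  have hcu := cnt_update N a' (some (f a))
  have hlt2 := hmax (Function.update N a' (some (f a))) ⟨⟨fun a'' x hx => by
      by_cases haa : a'' = a'
      · subst haa; rw [Function.update_self] at hx; cases hx; rw [← h1]; exact hE1 _
      · rw [Function.update_of_ne haa] at hx; exact hN.1 _ _ hx,
    fun x => by
      have e := hN.2 x
      have e1 := hcu (some x)
      rw [usage_eq_cnt] at *
      by_cases hx : f a = x
      · subst hx; simp [h2] at e1; omega
      · simp [hx] at e1; omega⟩, fun a'' => by
      by_cases haa : a'' = a'
      · subst haa; simp
      · rw [Function.update_of_ne haa]; exact hNp _⟩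
  refine absurd hlt2 (not_le.mpr ?_)
  apply Finset.card_lt_card
  rw [Finset.ssubset_iff_of_subset]
  · refine ⟨a', by simp [h1], by simpa [h1] using h2⟩
  · intro x hx
    simp only [Finset.mem_filter, Finset.mem_univ, true_and] at hx ⊢
    by_cases haa : x = a'
    · subst haa; simp [h1]
    · rw [Function.update_of_ne haa]; exact hx

lemma natcard_filter (p : α → Prop) : Nat.card {a // p a} = (Finset.univ.filter p).card := by
  rw [Nat.card_eq_fintype_card, Fintype.card_subtype]

lemma rank_f (f : α → β) (z : α → Option β) (last : α → β) (a : α) :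
    rankOf f z last a (f a) = 1 := by simp [rankOf]

lemma rank_z (f : α → β) (z : α → Option β) (last : α → β) (a : α) (b : β) (h : b ≠ f a)
    (hz : z a = some b) : rankOf f z last a b = 2 := by simp [rankOf, h, hz]

lemma rank_ge2 (f : α → β) (z : α → Option β) (last : α → β) (a : α) (b : β) (h : b ≠ f a) :
    2 ≤ rankOf f z last a b := by
  unfold rankOf
  rw [if_neg h]
  split_ifs
  · exact le_rfl
  · norm_num
  · exact le_top

lemma rank_ge3 (f : α → β) (z : α → Option β) (last : α → β) (a : α) (b : β) (h : b ≠ f a)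
    (hz : z a ≠ some b) : 3 ≤ rankOf f z last a b := by
  unfold rankOf
  rw [if_neg h, if_neg hz]
  split_ifs
  · exact le_rfl
  · exact le_top

lemma rank_last (f : α → β) (z : α → Option β) (last : α → β) (a : α) (h : last a ≠ f a)
    (hz : z a ≠ some (last a)) : rankOf f z last a (last a) = 3 := by simp [rankOf, h, hz]

lemma edge_iff (f : α → β) (z : α → Option β) (last : α → β) (a : α) (b : β) :
    Edge (rankOf f z last) a b ↔ b = f a ∨ z a = some b ∨ b = last a := by
  unfold Edge rankOf
  split_ifs <;> simp_all

lemma popular_of_full [Fintype β] (f : α → β) (z : α → Option β) (last : α → β)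
    (hne : ∀ a, f a ≠ last a ∧ z a ≠ some (f a) ∧ z a ≠ some (last a))
    (E : α → β → Prop)
    (hE : ∀ a b, E a b → b = f a ∨ b = sx f z last a)
    (hEf : ∀ a a', E a (f a') → f a = f a')
    (c : β → ℕ) (M : α → Option β) (hM : IsCapMatchingOn E c M)
    (hMp : ∀ a, M a ≠ none) (hfull : ∀ a, usage M (f a) = c (f a)) :
    PopularCap (rankOf f z last) c M := by
  refine ⟨⟨fun a b hab => ?_, hM.2⟩, ?_⟩
  · unfold Edge rankOf
    rcases hE a b (hM.1 a b hab) with h | h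
    · simp [h]
    · rcases sx_cases f z last a with ⟨h1, _⟩ | ⟨h1, _⟩
      · rw [← h] at h1; split_ifs <;> simp
      · rw [h1] at h; split_ifs <;> simp
  intro M' hM' hmp
  unfold MorePopular at hmp
  refine absurd hmp (not_lt.mpr ?_)
  rw [natcard_filter, natcard_filter]
  set I : Finset β := Finset.univ.filter (fun b => ∃ a, f a = b)
  -- people preferring `M'`
  have hA : Finset.univ.filter (Prefers (rankOf f z last) M' M) ⊆
      I.biUnion (fun b => Finset.univ.filter (fun a => M' a = some b ∧ M a ≠ some b)) := by
    intro a ha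
    simp only [Finset.mem_filter, Finset.mem_univ, true_and] at ha
    rcases ha with ⟨b, _, h⟩ | ⟨b, b', h1, h2, h3⟩
    · exact absurd h (hMp a)
    simp only [I, Finset.mem_biUnion, Finset.mem_filter, Finset.mem_univ, true_and]
    refine ⟨b, ?_, h1, ?_⟩
    · have hb' := hE a b' (hM.1 a b' h2)
      have hs := sx_cases f z last a
      by_contra hnf
      push Not at hnf
      have hbf : b ≠ f a := fun h => hnf a h.symm
      have hb2 := rank_ge2 f z last a b hbf
      rcases hb' with h | h
      · rw [h, rank_f] at h3
        have := hb2.trans h3.le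
        norm_num at this
      · rcases hs with ⟨h4, h5⟩ | ⟨h4, h5⟩
        · rw [← h] at h4 h5
          rw [rank_z f z last a b' (h5 a).symm h4] at h3
          exact absurd h3 (not_lt.mpr hb2)
        · rw [h4] at h
          have hb3 := rank_ge3 f z last a b hbf
            (fun hh => by obtain ⟨a', h'⟩ := h5 b hh; exact hnf a' h')
          rw [h, rank_last f z last a (hne a).1.symm (hne a).2.2] at h3
          exact absurd h3 (not_lt.mpr hb3)
    · rw [h2]
      rintro ⟨⟩
      exact lt_irrefl _ h3
  have hB : I.biUnion (fun b => Finset.univ.filter (fun a => M a = some b ∧ M' a ≠ some b)) ⊆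
      Finset.univ.filter (Prefers (rankOf f z last) M M') := by
    intro a ha
    simp only [I, Finset.mem_biUnion, Finset.mem_filter, Finset.mem_univ, true_and] at ha ⊢
    obtain ⟨b, ⟨a', rfl⟩, h1, h2⟩ := ha
    have hfa := hEf _ _ (hM.1 _ _ h1)
    cases h : M' a with
    | none => exact Or.inl ⟨_, h1, h⟩
    | some b' =>
      refine Or.inr ⟨_, b', h1, h, ?_⟩
      have hb' : b' ≠ f a := by
        rintro rfl
        exact h2 (by rw [h, hfa])
      rw [← hfa, rank_f]
      exact lt_of_lt_of_le (by norm_num) (rank_ge2 f z last a b' hb')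
  calc _ ≤ _ := Finset.card_le_card hA
    _ ≤ ∑ b ∈ I, (Finset.univ.filter (fun a => M' a = some b ∧ M a ≠ some b)).card :=
        Finset.card_biUnion_le
    _ ≤ ∑ b ∈ I, (Finset.univ.filter (fun a => M a = some b ∧ M' a ≠ some b)).card := by
        apply Finset.sum_le_sum
        intro b hb
        simp only [I, Finset.mem_filter, Finset.mem_univ, true_and] at hb
        obtain ⟨a, rfl⟩ := hb
        have e1 := hfull a
        have e2 := hM'.2 (f a)
        rw [usage_eq_cnt, cnt] at e1 e2
        rw [← Finset.card_filter_add_card_filter_not (s := Finset.univ.filter _)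
          (fun x => M' x = some (f a))] at e1
        rw [← Finset.card_filter_add_card_filter_not (s := Finset.univ.filter _)
          (fun x => M x = some (f a))] at e2
        simp only [Finset.filter_filter] at e1 e2
        simp only [and_comm (a := M _ = some (f a)) (b := M' _ = some (f a))] at e1
        simp only [ne_eq]
        omega
    _ = _ := by
        rw [Finset.card_biUnion]
        intro x _ y _ hxy
        rw [Function.onFun, Finset.disjoint_left]
        intro a ha hb
        simp only [Finset.mem_filter, Finset.mem_univ, true_and] at ha hb
        exact hxy (Option.some_injective _ (ha.1.symm.trans hb.1))
    _ ≤ _ := Finset.card_le_card hB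

lemma not_prefers_of_eq (rank : α → β → ℕ∞) (M M' : α → Option β) (a : α) (h : M a = M' a) :
    ¬ Prefers rank M M' a := by
  rintro (⟨b, h1, h2⟩ | ⟨b, b', h1, h2, h3⟩)
  · rw [← h, h1] at h2; cases h2
  · rw [← h, h1] at h2; cases h2; exact lt_irrefl _ h3

lemma not_popular (rank : α → β → ℕ∞) (c : β → ℕ) (M M' : α → Option β)
    (hM' : IsCapMatchingOn (Edge rank) c M') (S T : Finset α) (hST : T.card < S.card)
    (hT : ∀ a, Prefers rank M M' a → a ∈ T) (hS : ∀ a ∈ S, Prefers rank M' M a) :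
    ¬ PopularCap rank c M := by
  intro h
  apply h.2 M' hM'
  unfold MorePopular
  rw [natcard_filter, natcard_filter]
  calc _ ≤ T.card := Finset.card_le_card (fun a ha => hT a (by simpa using ha))
    _ < S.card := hST
    _ ≤ _ := Finset.card_le_card (fun a ha => by simpa using hS a ha)

lemma exists_user (M : α → Option β) (b : β) (h : 1 ≤ usage M b) : ∃ a, M a = some b := by
  rw [usage_eq_cnt, cnt] at h
  obtain ⟨a, ha⟩ := Finset.card_pos.mp h
  exact ⟨a, by simpa using ha⟩

lemma popular_second (f : α → β) (z : α → Option β) (last : α → β)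
    (hpriv : ∀ a a', f a' ≠ last a ∧ z a' ≠ some (last a))
    (c : β → ℕ) (hc : ∀ b, 1 ≤ c b) (M : α → Option β)
    (hM : PopularCap (rankOf f z last) c M) (a : α) (x : β) (hx : ∀ a', f a' ≠ x)
    (hz : z a = some x) (hnf : M a ≠ some (f a)) : M a = some x := by
  by_contra hnx
  have hMa : M a = none ∨ M a = some (last a) := by
    cases h : M a with
    | none => exact Or.inl rfl
    | some y =>
      right
      rcases (edge_iff f z last a y).mp (hM.1.1 a y h) with h1 | h1 | h1
      · rw [h1] at h; exact absurd h hnf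
      · exact absurd (h.trans (h1.symm.trans hz)) hnx
      · rw [h1]
  have hxr : rankOf f z last a x = 2 := rank_z f z last a x (hx a).symm hz
  have hpa : ∀ M' : α → Option β, M' a = some x → Prefers (rankOf f z last) M' M a := by
    intro M' h
    rcases hMa with h1 | h1
    · exact Or.inl ⟨x, h, h1⟩
    · refine Or.inr ⟨x, last a, h, h1, ?_⟩
      rw [hxr, rank_last f z last a (hpriv a a).1.symm (hpriv a a).2]
      norm_num
  have hEx : Edge (rankOf f z last) a x := (edge_iff ..).mpr (Or.inr (Or.inl hz))
  have hcu1 := cnt_update M a (some x)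
  have hMax : ∀ y, (if M a = some y then 1 else 0) ≤ cnt M (some y) := by
    intro y
    split_ifs with h
    · exact Finset.card_pos.mpr ⟨a, by simpa using h⟩
    · omega
  have hupd : ∀ (N : α → Option β) (p : α) (o : Option β),
      (∀ a b, N a = some b → Edge (rankOf f z last) a b) →
      (∀ b, o = some b → Edge (rankOf f z last) p b) →
      ∀ a b, Function.update N p o a = some b → Edge (rankOf f z last) a b := by
    intro N p o h1 h2 a b h3
    by_cases hap : a = p
    · subst hap; rw [Function.update_self] at h3; exact h2 b h3
    · rw [Function.update_of_ne hap] at h3; exact h1 a b h3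
  have hV1 := hupd M a (some x) hM.1.1 (by rintro b ⟨⟩; exact hEx)
  by_cases hu : usage M x < c x
  · refine not_popular (rankOf f z last) c M (Function.update M a (some x)) ⟨hV1, ?_⟩
      {a} ∅ (by simp) ?_ ?_ hM
    · intro y
      have e1 := hcu1 (some y)
      have e2 := hM.1.2 y
      rw [usage_eq_cnt] at *
      by_cases hy : x = y
      · subst hy; simp [hnx] at e1; omega
      · simp [hy] at e1; omega
    · intro p hp
      by_cases hpe : p = a
      · subst hpe
        exfalso
        rcases hp with ⟨b, h1, h2⟩ | ⟨b, b', h1, h2, h3⟩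
        · simp at h2
        · rw [Function.update_self] at h2
          cases h2
          rcases hMa with h4 | h4
          · rw [h4] at h1; cases h1
          · rw [h4] at h1; cases h1
            rw [hxr, rank_last f z last p (hpriv p p).1.symm (hpriv p p).2] at h3
            norm_num at h3
      · exact absurd hp (not_prefers_of_eq _ _ _ _ (by rw [Function.update_of_ne hpe]))
    · intro p hp
      rw [Finset.mem_singleton] at hp
      subst hp
      exact hpa _ (by simp)
  obtain ⟨a', ha'⟩ := exists_user M x (by have := hc x; omega)
  have hne' : a' ≠ a := by rintro rfl; exact hnx ha'
  have hza' : z a' = some x := by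
    rcases (edge_iff f z last a' x).mp (hM.1.1 a' x ha') with h | h | h
    · exact absurd h.symm (hx a')
    · exact h
    · exact absurd (hz.trans (by rw [h])) (hpriv a' a).2
  have hMafa : M a ≠ some (f a') := by
    rcases hMa with h | h
    · rw [h]; simp
    · rw [h]; intro e; exact (hpriv a a').1 (Option.some_injective _ e).symm
  have hxf : x ≠ f a' := (hx a').symm
  set M2 := Function.update (Function.update M a (some x)) a' (some (f a')) with hM2
  have hV2 : ∀ a b, M2 a = some b → Edge (rankOf f z last) a b :=
    hupd _ a' (some (f a')) hV1 (by rintro b ⟨⟩; exact (edge_iff ..).mpr (Or.inl rfl))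
  have hcu2 := cnt_update (Function.update M a (some x)) a' (some (f a'))
  rw [Function.update_of_ne hne', ha', ← hM2] at hcu2
  have hpa' : ∀ M' : α → Option β, M' a' = some (f a') → Prefers (rankOf f z last) M' M a' := by
    intro M' h
    refine Or.inr ⟨f a', x, h, ha', ?_⟩
    rw [rank_f]
    exact lt_of_lt_of_le (by norm_num) (rank_ge2 f z last a' x hxf)
  have hasym : ∀ M' p, Prefers (rankOf f z last) M' M p → ¬ Prefers (rankOf f z last) M M' p := by
    rintro M' p (⟨b, h1, h2⟩ | ⟨b, b', h1, h2, h3⟩) (⟨d, g1, g2⟩ | ⟨d, d', g1, g2, g3⟩)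
    · rw [h1] at g2; cases g2
    · rw [h2] at g1; cases g1
    · rw [h1] at g2; cases g2
    · rw [h1] at g2; rw [h2] at g1; cases g1; cases g2
      exact lt_asymm h3 g3
  have hbound : ∀ y, cnt M2 (some y) ≤ cnt M (some y) + (if f a' = y then 1 else 0) := by
    intro y
    have e1 := hcu1 (some y)
    have e2 := hcu2 (some y)
    simp only [Option.some.injEq] at e1 e2
    omega
  have hM2a : M2 a = some x := by
    rw [hM2, Function.update_of_ne hne'.symm, Function.update_self]
  have hM2a' : M2 a' = some (f a') := by rw [hM2, Function.update_self]
  have hM2o : ∀ p, p ≠ a → p ≠ a' → M2 p = M p := by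
    intro p h1 h2
    rw [hM2, Function.update_of_ne h2, Function.update_of_ne h1]
  by_cases hu2 : usage M (f a') < c (f a')
  · refine not_popular (rankOf f z last) c M M2 ⟨hV2, ?_⟩ {a} ∅ (by simp) ?_ ?_ hM
    · intro y
      have e1 := hbound y
      have e2 := hM.1.2 y
      rw [usage_eq_cnt] at *
      split_ifs at e1 with hy
      · subst hy; omega
      · omega
    · intro p hp
      exfalso
      by_cases h1 : p = a
      · subst h1; exact hasym _ _ (hpa M2 hM2a) hp
      by_cases h2 : p = a'
      · subst h2; exact hasym _ _ (hpa' M2 hM2a') hp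
      exact not_prefers_of_eq _ _ _ _ (hM2o p h1 h2).symm hp
    · intro p hp
      rw [Finset.mem_singleton] at hp
      subst hp
      exact hpa _ hM2a
  obtain ⟨a'', ha''⟩ := exists_user M (f a') (by have := hc (f a'); omega)
  have h31 : a'' ≠ a := by rintro rfl; exact hMafa ha''
  have h32 : a'' ≠ a' := by
    rintro rfl; rw [ha'] at ha''; exact hxf (Option.some_injective _ ha'')
  have hcu3 := cnt_update M2 a'' none
  rw [hM2o a'' h31 h32, ha''] at hcu3
  refine not_popular (rankOf f z last) c M (Function.update M2 a'' none)
    ⟨hupd _ _ _ hV2 (by rintro b ⟨⟩), ?_⟩ {a, a'} {a''} ?_ ?_ ?_ hM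
  · intro y
    have e1 := hbound y
    have e2 := hM.1.2 y
    have e3 := hcu3 (some y)
    rw [usage_eq_cnt] at *
    simp only [Option.some.injEq, reduceCtorEq, if_false] at e3
    omega
  · rw [Finset.card_pair hne'.symm]; simp
  · intro p hp
    by_contra hps
    rw [Finset.mem_singleton] at hps
    by_cases h1 : p = a
    · subst h1
      exact hasym _ _ (hpa _ (by rw [Function.update_of_ne hps, hM2a])) hp
    by_cases h2 : p = a'
    · subst h2
      exact hasym _ _ (hpa' _ (by rw [Function.update_of_ne hps, hM2a'])) hp
    exact not_prefers_of_eq _ _ _ _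
      (by rw [Function.update_of_ne hps, hM2o p h1 h2]) hp
  · intro p hp
    rw [Finset.mem_insert, Finset.mem_singleton] at hp
    rcases hp with rfl | rfl
    · exact hpa _ (by rw [Function.update_of_ne h31.symm, hM2a])
    · exact hpa' _ (by rw [Function.update_of_ne h32.symm, hM2a'])

lemma perfect_of_popular (f : α → β) (z : α → Option β) (last : α → β)
    (hlastinj : Function.Injective last)
    (hpriv : ∀ a a', f a' ≠ last a ∧ z a' ≠ some (last a))
    (ev : α → Prop) (hev : ∀ a a', a' ≠ a → f a' = f a → ev a)
    (c : β → ℕ) (hc : ∀ b, 1 ≤ c b) (M : α → Option β)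
    (hM : PopularCap (rankOf f z last) c M) :
    ∃ N, IsCapMatchingOn (fun a b => b = f a ∨ (ev a ∧ b = sx f z last a)) c N ∧
      ∀ a, N a ≠ none := by
  refine ⟨fun a => if M a = some (f a) ∨ ¬ ev a then some (f a) else some (sx f z last a),
    ⟨?_, ?_⟩, ?_⟩
  · intro a b h
    dsimp only at h
    split_ifs at h with h1
    · cases h; exact Or.inl rfl
    · cases h; push Not at h1; exact Or.inr ⟨h1.2, rfl⟩
  · intro x
    have hone : ∀ (N : α → Option β) (a0 : α), (∀ a, N a = some x → a = a0) →
        usage N x ≤ c x := by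
      intro N a0 h
      refine le_trans ?_ (hc x)
      refine (cnt_le_of_imp N x (fun a => a = a0) h).trans ?_
      rw [Finset.card_le_one]
      intro p hp q hq
      simp only [Finset.mem_filter, Finset.mem_univ, true_and] at hp hq
      rw [hp, hq]
    have hsub : ∀ (N : α → Option β), (∀ a, N a = some x → M a = some x) →
        usage N x ≤ c x := by
      intro N h
      refine le_trans ?_ (hM.1.2 x)
      refine (cnt_le_of_imp N x (fun a => M a = some x) h).trans ?_
      rw [usage_eq_cnt, cnt]
      exact le_of_eq (by congr)
    by_cases hxf : ∃ a0, f a0 = x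
    · obtain ⟨a0, rfl⟩ := hxf
      by_cases hex : ∃ a1, f a1 = f a0 ∧ ¬ ev a1
      · obtain ⟨a1, h1, h2⟩ := hex
        apply hone _ a1
        intro a ha
        by_contra hne
        apply h2
        apply hev a1 a hne
        rw [h1]
        split_ifs at ha
        · exact Option.some_injective _ ha
        · exact absurd (Option.some_injective _ ha) (sx_ne_f f z last hpriv a a0)
      · push Not at hex
        apply hsub
        intro a ha
        split_ifs at ha with h
        · have hf := Option.some_injective _ ha
          rcases h with h | h
          · rw [h, hf]
          · exact absurd (hex a hf) h
        · exact absurd (Option.some_injective _ ha) (sx_ne_f f z last hpriv a a0)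
    · push Not at hxf
      have hs : ∀ a, (if M a = some (f a) ∨ ¬ ev a then some (f a) else some (sx f z last a))
          = some x → M a ≠ some (f a) ∧ sx f z last a = x := by
        intro a ha
        split_ifs at ha with h
        · exact absurd (Option.some_injective _ ha) (hxf a)
        · push Not at h
          exact ⟨h.1, Option.some_injective _ ha⟩
      by_cases hl : ∃ a0, last a0 = x
      · obtain ⟨a0, rfl⟩ := hl
        apply hone _ a0
        intro a ha
        have h1 := (hs a ha).2
        rcases sx_cases f z last a with ⟨h2, _⟩ | ⟨h2, _⟩
        · rw [h1] at h2
          exact absurd h2 (hpriv a0 a).2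
        · exact hlastinj (h2.symm.trans h1)
      · push Not at hl
        apply hsub
        intro a ha
        obtain ⟨h0, h1⟩ := hs a ha
        rcases sx_cases f z last a with ⟨h2, h3⟩ | ⟨h2, _⟩
        · rw [h1] at h2 h3
          exact popular_second f z last hpriv c hc M hM a x h3 h2 h0
        · exact absurd (h2.symm.trans h1) (hl a)
  · intro a
    dsimp only
    split_ifs <;> simp

end Helpers2

/-- Correctness of the greedy augmentation for strict lists of length at most 2:
any run of the algorithm that repeatedly duplicates a minimum-cost item odd with respect
to a maximum matching of the current graph `H'ᵢ` of `f`- and `s`-edges increases the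
maximum matching size by exactly one per iteration, never changes any person's `s`-item,
ends after `|A| - |M₀|` iterations with a graph admitting a popular matching, and its
total duplication cost is minimum among all augmentations admitting a popular matching. -/
theorem greedy_augmentation_correct {α β : Type*} [Fintype α] [Fintype β]
    (f : α → β) (z : α → Option β) (last : α → β) (cost : β → ℝ)
    (hcost : ∀ b, 0 ≤ cost b)
    (hlastinj : Function.Injective last)
    (hpriv : ∀ a a', f a' ≠ last a ∧ z a' ≠ some (last a))
    (hne : ∀ a, f a ≠ last a ∧ z a ≠ some (f a) ∧ z a ≠ some (last a))
    (M1 : α → Option β) (hM1 : IsMaxCapMatchingOn (E1f f) (fun _ => 1) M1)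
    (M0 : α → Option β) (hM0 : IsMaxCapMatchingOn (Ered f z last M1) (fun _ => 1) M0)
    (k : ℕ) (hk : k = Fintype.card α - msize M0)
    (seq : ℕ → β → ℕ) (hseq0 : seq 0 = fun _ => 1)
    (hstep : ∀ i < k, ∃ b Mi,
      IsMaxCapMatchingOn (Ered f z last M1) (seq i) Mi ∧
      COddB (Ered f z last M1) (seq i) Mi b ∧
      (∀ b', COddB (Ered f z last M1) (seq i) Mi b' → cost b ≤ cost b') ∧
      seq (i + 1) = Function.update (seq i) b (seq i b + 1)) :
    -- the maximum matching size of H' grows by exactly one per iteration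
    (∀ i < k, ∀ Mi Mj, IsMaxCapMatchingOn (Ered f z last M1) (seq i) Mi →
      IsMaxCapMatchingOn (Ered f z last M1) (seq (i + 1)) Mj →
      msize Mj = msize Mi + 1) ∧
    -- the s-item of every person is unchanged throughout
    (∀ i ≤ k, ∀ M1', IsMaxCapMatchingOn (E1f f) (seq i) M1' →
      ∀ a, sItemC f z last (seq i) M1' a = sItemC f z last (fun _ => 1) M1 a) ∧
    -- the final graph admits an A-perfect matching in G', hence a popular matching
    (∃ M, IsCapMatchingOn (Ered f z last M1) (seq k) M ∧ ∀ a, (M a).isSome) ∧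
    (∃ M, PopularCap (rankOf f z last) (seq k) M) ∧
    -- optimality of the total cost of duplication
    (∀ copies' : β → ℕ, (∀ b, 1 ≤ copies' b) →
      (∃ M, PopularCap (rankOf f z last) copies' M) →
      (∑ b : β, ((seq k b - 1 : ℕ) : ℝ) * cost b) ≤
        ∑ b : β, ((copies' b - 1 : ℕ) : ℝ) * cost b) := by
  have hone : ∀ a, (fun _ : β => 1) (f a) ≤ fdeg f (f a) := fun a => fdeg_pos f a
  have hS : ∀ a, sItemC f z last (fun _ => 1) M1 a = sx f z last a :=
    sItemC_eq f z last _ M1 hM1 (fun _ => le_rfl) hone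
  have hE1 : ∀ a, Ered f z last M1 a (f a) := fun a => Or.inl rfl
  have hE : ∀ a b, Ered f z last M1 a b → b = f a ∨ b = sx f z last a := by
    rintro a b (h | ⟨_, h⟩)
    · exact Or.inl h
    · rw [hS] at h; exact Or.inr h
  have hEf : ∀ a a', Ered f z last M1 a (f a') → f a = f a' := by
    intro a a' h
    rcases hE a _ h with h | h
    · exact h.symm
    · exact absurd h.symm (sx_ne_f f z last hpriv a a')
  have hinv := seq_inv f _ hEf cost k seq hseq0 hstep
  have hsize := size_seq _ cost k seq hstep
  have hperf : ∃ M, IsCapMatchingOn (Ered f z last M1) (seq k) M ∧ ∀ a, (M a).isSome := by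
    have hgrow : ∀ i ≤ k, ∀ M, IsMaxCapMatchingOn (Ered f z last M1) (seq i) M →
        msize M = msize M0 + i := by
      intro i
      induction i with
      | zero =>
        intro _ M hM
        rw [hseq0] at hM
        have := hM.2 M0 hM0.1
        have := hM0.2 M hM.1
        omega
      | succ i ih =>
        intro hi M hM
        obtain ⟨N, hN⟩ := exists_max (Ered f z last M1) (seq i)
        have := ih (by omega) N hN
        have := hsize i (by omega) N M hN hM
        omega
    obtain ⟨N, hN⟩ := exists_max (Ered f z last M1) (seq k)
    have := hgrow k le_rfl N hN
    exact ⟨N, hN.1, isSome_of_msize N (by omega)⟩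
  refine ⟨hsize, ?_, hperf, ?_, ?_⟩
  · intro i hi M1' hM1' a
    obtain ⟨h1, h2⟩ := hinv i hi
    rw [hS, sItemC_eq f z last _ M1' hM1' h1 h2]
  · obtain ⟨M, hM, hMp⟩ := hperf
    obtain ⟨N, hN, hNp, hfull⟩ := exists_full f _ hE1 (seq k) (hinv k le_rfl).2 M hM
      (fun a => Option.isSome_iff_ne_none.mp (hMp a))
    exact ⟨N, popular_of_full f z last hne _ hE hEf (seq k) N hN hNp hfull⟩
  · rintro c' hc' ⟨M, hM⟩
    obtain ⟨N, hN, hNp⟩ := perfect_of_popular f z last hlastinj hpriv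
      (CEvenA (E1f f) (fun _ => 1) M1) (evenA_of f M1 hM1) c' hc' M hM
    have hN' : IsCapMatchingOn (Ered f z last M1) c' N := by
      refine ⟨fun a b h => ?_, hN.2⟩
      rcases hN.1 a b h with h | ⟨h1, h2⟩
      · exact Or.inl h
      · exact Or.inr ⟨h1, by rw [hS]; exact h2⟩
    obtain ⟨d, N2, hd, _, _, hcst⟩ := greedy_opt _ cost k seq hstep c' N hN' hNp
      (by rw [hseq0]; exact hc') k le_rfl
    have hconv : ∀ e : β → ℕ, (∀ b, 1 ≤ e b) → ∑ b : β, ((e b - 1 : ℕ) : ℝ) * cost b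
        = ∑ b : β, (e b : ℝ) * cost b - ∑ b : β, cost b := by
      intro e he
      rw [← Finset.sum_sub_distrib]
      apply Finset.sum_congr rfl
      intro b _
      rw [Nat.cast_sub (he b)]
      push_cast
      ring
    rw [hconv _ (hinv k le_rfl).1, hconv _ hc']
    have : ∑ b : β, (seq k b : ℝ) * cost b ≤ ∑ b : β, (d b : ℝ) * cost b := by
      apply Finset.sum_le_sum
      intro b _
      exact mul_le_mul_of_nonneg_right (by exact_mod_cast hd b) (hcost b)
    linarith
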